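/- Let A be a strictly full triangulated subcategory of a triangulated category D. Then the épaisse (thick) envelope of A in D, i.e. the smallest strictly full triangulated subcategory of D containing A and closed under direct summands, consists exactly of the direct summands in D of objects of A. -/

import Mathlib

/- STATEMENT 9: the épaisse (thick) envelope of a strictly full triangulated
subcategory A of a triangulated category consists exactly of the direct
summands of objects of A.
-/

open CategoryTheory Limits Pretriangulated Opposite

universe v u

variable {C : Type u} [Category.{v} C] [HasZeroObject C] [Preadditive C]
  [HasShift C ℤ] [∀ n : ℤ, (shiftFunctor C n).Additive] [Pretriangulated C]

/-- `Y` is a direct sum of `X` and `Z`. -/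
def IsDirectSumOf (Y X Z : C) : Prop :=
  ∃ (i : X ⟶ Y) (j : Z ⟶ Y) (p : Y ⟶ X) (q : Y ⟶ Z),
    i ≫ p = 𝟙 X ∧ j ≫ q = 𝟙 Z ∧ i ≫ q = 0 ∧ j ≫ p = 0 ∧ p ≫ i + q ≫ j = 𝟙 Y

/-- `X` is a direct summand of `Y`. -/
def IsSummand (X Y : C) : Prop := ∃ Z : C, IsDirectSumOf Y X Z

/-- `smd A`: closure of a class of objects under direct summands. -/
def smd (A : Set C) : Set C := {X | ∃ Y ∈ A, IsSummand X Y}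

/-- a class of objects is closed under direct summands. -/
def SmdClosed (A : Set C) : Prop := ∀ ⦃X Y : C⦄, IsSummand X Y → Y ∈ A → X ∈ A

/-- `S` is (the class of objects of) a strictly full triangulated subcategory:
it is closed under isomorphisms, under shifts, and under cones of morphisms
between its objects. -/
structure IsTriangulatedSub (S : Set C) : Prop where
  iso : ∀ ⦃X Y : C⦄, (X ≅ Y) → X ∈ S → Y ∈ S
  shift : ∀ (X : C) (n : ℤ), X ∈ S → X⟦n⟧ ∈ S
  cone : ∀ T : Triangle C, T ∈ (distTriang C) → T.obj₁ ∈ S → T.obj₂ ∈ S → T.obj₃ ∈ S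

/-- the épaisse (thick) envelope of `S`: the smallest strictly full triangulated
subcategory containing `S` and closed under direct summands. -/
def ThickEnvelope (S : Set C) : Set C :=
  ⋂₀ {T : Set C | S ⊆ T ∧ IsTriangulatedSub T ∧ SmdClosed T}

/-- In a pretriangulated category, the direct summands of an object are its retracts. -/
theorem isSummand_iff_nonempty_retract (X Y : C) : IsSummand X Y ↔ Nonempty (Retract X Y) := by
  constructor
  · rintro ⟨Z, i, j, p, q, hip, -⟩
    exact ⟨⟨i, p, hip⟩⟩
  · rintro ⟨⟨i, r, hir⟩⟩
    obtain ⟨Z, g, h, hT⟩ := distinguished_cocone_triangle i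
    have : Mono i := mono_of_mono_fac hir
    have hg : Epi g := (Triangle.mk i g h).epi₂ hT
      ((Triangle.mk i g h).mor₃_eq_zero_of_mono₁ hT this)
    have hig : i ≫ g = 0 := comp_distTriang_mor_zero₁₂ _ hT
    obtain ⟨j, hj⟩ : ∃ j : Z ⟶ Y, 𝟙 Y - r ≫ i = g ≫ j :=
      Triangle.yoneda_exact₂ _ hT (𝟙 Y - r ≫ i)
        (show i ≫ (𝟙 Y - r ≫ i) = 0 by simp [reassoc_of% hir])
    refine ⟨Z, i, j, r, g, hir, ?_, hig, ?_, ?_⟩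
    · rw [← cancel_epi g, ← Category.assoc, ← hj]
      simp [hig]
    · rw [← cancel_epi g, ← Category.assoc, ← hj]
      simp [hir]
    · rw [← hj, add_sub_cancel]

theorem smd_eq_retractClosure (S : Set C) :
    smd S = {X | ObjectProperty.retractClosure (· ∈ S) X} := by
  ext X
  simp [smd, ObjectProperty.prop_retractClosure_iff, isSummand_iff_nonempty_retract]

theorem subset_smd (S : Set C) : S ⊆ smd S := fun X hX =>
  ⟨X, hX, (isSummand_iff_nonempty_retract X X).2 ⟨Retract.refl X⟩⟩

theorem smdClosed_smd (S : Set C) : SmdClosed (smd S) := by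
  rintro X Y hXY ⟨Z, hZ, hYZ⟩
  rw [isSummand_iff_nonempty_retract] at hXY hYZ
  obtain ⟨r⟩ := hXY
  obtain ⟨s⟩ := hYZ
  exact ⟨Z, hZ, (isSummand_iff_nonempty_retract X Z).2 ⟨r.trans s⟩⟩

/-- A strictly full triangulated subcategory is closed under extensions. -/
theorem IsTriangulatedSub.extensionProduct_le {S : Set C} (hS : IsTriangulatedSub S) :
    ObjectProperty.extensionProduct (· ∈ S) (· ∈ S) ≤ (· ∈ S) := by
  rintro X ⟨Y, Z, f, g, h, hT, hY, hZ⟩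
  exact hS.cone _ (inv_rot_of_distTriang _ hT) (hS.shift Z (-1) hZ) hY

/-- The direct summands of objects of a strictly full triangulated subcategory form a strictly
full triangulated subcategory. -/
theorem IsTriangulatedSub.smd {S : Set C} (hS : IsTriangulatedSub S) :
    IsTriangulatedSub (smd S) where
  iso X Y e hX :=
    smdClosed_smd S ((isSummand_iff_nonempty_retract Y X).2 ⟨Retract.ofIso e.symm⟩) hX
  shift := by
    rintro X n ⟨Y, hY, hXY⟩
    obtain ⟨r⟩ := (isSummand_iff_nonempty_retract X Y).1 hXY
    exact ⟨Y⟦n⟧, hS.shift Y n hY,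
      (isSummand_iff_nonempty_retract _ _).2 ⟨r.map (shiftFunctor C n)⟩⟩
  cone T hT h₁ h₂ := by
    obtain ⟨Y, hY, hY₁⟩ := h₁
    obtain ⟨r⟩ := (isSummand_iff_nonempty_retract _ _).1 hY₁
    rw [smd_eq_retractClosure] at h₂ ⊢
    exact ObjectProperty.monotone_retractClosure hS.extensionProduct_le _
      (ObjectProperty.extensionProduct_retractClosure_retractClosure_le _ _ _
        ⟨_, _, _, _, _, rot_of_distTriang _ hT, h₂,
          ⟨Y⟦(1 : ℤ)⟧, hS.shift Y 1 hY, ⟨r.map (shiftFunctor C (1 : ℤ))⟩⟩⟩)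

theorem thickEnvelope_eq_summands [IsTriangulated C] (S : Set C)
    (hS : IsTriangulatedSub S) :
    ThickEnvelope S = {X : C | ∃ Y ∈ S, IsSummand X Y} := by
  apply Set.Subset.antisymm
  · exact Set.sInter_subset_of_mem ⟨subset_smd S, hS.smd, smdClosed_smd S⟩
  · rintro X ⟨Y, hY, hXY⟩ T ⟨hST, -, hT⟩
    exact hT hXY (hST hY)
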